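/- For every integer i ≥ 1, the rational number b_{(i,3,1)} equals (i² − i)/(6(i+1)(i+2)(i+3)). -/

import Mathlib

open Finset

/-- `b i j k` from the paper, defined for `i ≥ 1` (we set `b 0 _ _ = 0`):
`b 1 j 0 = -1/j!`, `b 1 j k = (-1)^(j+1-k) * B_(j+1-k) / (j+1-k)!` for `k ≥ 1`, and for `i ≥ 2`,
`b i j k = ∑_{m=0}^{min(j, i+j-k)} ((-1)^m B_m / m!) * b (i-1) (j+1-m) k - (if k = 0 then 1/j! else 0)`.
Here `bernoulli` is Mathlib's Bernoulli number, with EGF `t/(e^t - 1)` (so `bernoulli 1 = -1/2`). -/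
def b : ℕ → ℕ → ℕ → ℚ
  | 0, _, _ => 0
  | 1, j, k =>
      if k = 0 then -(1 / (Nat.factorial j : ℚ))
      else (-1) ^ (j + 1 - k) * bernoulli (j + 1 - k) / (Nat.factorial (j + 1 - k) : ℚ)
  | (i + 2), j, k =>
      (∑ m ∈ Finset.range (min j (i + 2 + j - k) + 1),
        ((-1) ^ m * bernoulli m / (Nat.factorial m : ℚ)) * b (i + 1) (j + 1 - m) k)
      - (if k = 0 then 1 / (Nat.factorial j : ℚ) else 0)

open PowerSeries in
/-- The power series `1 - e^(-t)`. -/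
noncomputable def oneSubExpNeg : PowerSeries ℚ := 1 - rescale (-1 : ℚ) (exp ℚ)

open PowerSeries in
/-- The power series `t / (1 - e^(-t))`. -/
noncomputable def toddSeries : PowerSeries ℚ := rescale (-1 : ℚ) (bernoulliPowerSeries ℚ)

namespace oneSubExpNeg

open PowerSeries

theorem coeff_toddSeries (m : ℕ) :
    coeff m toddSeries = (-1) ^ m * bernoulli m / (Nat.factorial m : ℚ) := by
  simp [toddSeries, bernoulliPowerSeries, coeff_rescale, mul_div_assoc]

theorem toddSeries_mul : toddSeries * oneSubExpNeg = X := by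
  have h := congrArg (rescale (-1 : ℚ)) (bernoulliPowerSeries_mul_exp_sub_one ℚ)
  rw [map_mul, map_sub, map_one, rescale_X] at h
  simp only [map_neg, map_one, neg_mul, one_mul] at h
  rw [toddSeries, oneSubExpNeg]
  linear_combination -h

theorem constantCoeff_eq_zero : constantCoeff oneSubExpNeg = 0 := by
  rw [← coeff_zero_eq_constantCoeff_apply, oneSubExpNeg, map_sub, coeff_rescale]
  simp

theorem coeff_pow_of_lt {n j : ℕ} (h : j < n) : coeff j (oneSubExpNeg ^ n) = 0 :=
  X_pow_dvd_iff.mp (pow_dvd_pow_of_dvd (X_dvd_iff.mpr constantCoeff_eq_zero) n) j h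

theorem derivative_eq : derivative ℚ oneSubExpNeg = 1 - oneSubExpNeg := by
  ext n
  have : ((n : ℚ) + 1) ≠ 0 := by positivity
  have h2 : (Nat.factorial n : ℚ) ≠ 0 := by positivity
  simp only [oneSubExpNeg, coeff_derivative, map_sub, coeff_rescale, coeff_exp, coeff_one]
  simp [Nat.factorial_succ]
  field_simp
  ring

/-- The coefficients of `∑ uⁿ / n`, where `u = 1 - e^(-t)`, are those of `t`. -/
theorem sum_coeff_pow_div {j N : ℕ} (hj : 1 ≤ j) (hN : j ≤ N) :
    ∑ n ∈ range N, coeff j (oneSubExpNeg ^ (n + 1)) / ((n : ℚ) + 1) = if j = 1 then 1 else 0 := by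
  obtain ⟨k, rfl⟩ : ∃ k, j = k + 1 := ⟨j - 1, by omega⟩
  have hk : (k : ℚ) + 1 ≠ 0 := by positivity
  have key (n : ℕ) : coeff (k + 1) (oneSubExpNeg ^ (n + 1)) / ((n : ℚ) + 1) * (k + 1) =
      coeff k (oneSubExpNeg ^ n) - coeff k (oneSubExpNeg ^ (n + 1)) := by
    have hn : (n : ℚ) + 1 ≠ 0 := by positivity
    have h : derivative ℚ (oneSubExpNeg ^ (n + 1)) =
        C ((n : ℚ) + 1) * (oneSubExpNeg ^ n - oneSubExpNeg ^ (n + 1)) := by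
      rw [Derivation.leibniz_pow, derivative_eq]
      simp only [Nat.add_sub_cancel, smul_eq_mul, nsmul_eq_mul, map_add, map_one, map_natCast]
      push_cast
      ring
    have h' := congrArg (coeff k) h
    rw [coeff_derivative, coeff_C_mul, map_sub] at h'
    field_simp
    linear_combination h'
  have hs : (∑ n ∈ range N, coeff (k + 1) (oneSubExpNeg ^ (n + 1)) / ((n : ℚ) + 1)) * (k + 1) =
      if k = 0 then 1 else 0 := by
    rw [Finset.sum_mul, Finset.sum_congr rfl fun n _ => key n,
      Finset.sum_range_sub' (fun n => coeff k (oneSubExpNeg ^ n)),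
      coeff_pow_of_lt (show k < N by omega), pow_zero, coeff_one, sub_zero]
  rcases Nat.eq_zero_or_pos k with rfl | h0
  · simpa using hs
  · rw [if_neg (by omega)] at hs ⊢
    exact (mul_eq_zero.mp hs).resolve_right hk

theorem sum_coeff_toddSeries_mul (n j : ℕ) :
    ∑ m ∈ range (j + 1), coeff m toddSeries * coeff (j + 1 - m) (oneSubExpNeg ^ (n + 1)) =
      coeff j (oneSubExpNeg ^ n) := by
  have h : toddSeries * oneSubExpNeg ^ (n + 1) = X * oneSubExpNeg ^ n := by
    rw [pow_succ', ← mul_assoc, toddSeries_mul]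
  have h' := congrArg (coeff (j + 1)) h
  rw [coeff_succ_X_mul, coeff_mul, Finset.Nat.sum_antidiagonal_eq_sum_range_succ
    (fun a c => coeff a toddSeries * coeff c (oneSubExpNeg ^ (n + 1))),
    Finset.sum_range_succ, Nat.sub_self, coeff_pow_of_lt (Nat.succ_pos n), mul_zero, add_zero] at h'
  exact h'

theorem sum_toddSeries_step {f : ℕ → ℚ} {i : ℕ}
    (hf : ∀ j N, 1 ≤ j → j ≤ N →
      f j = ∑ n ∈ range N, coeff j (oneSubExpNeg ^ (n + 1)) / ((n : ℚ) + 1 + i))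
    (j N : ℕ) (hj : 1 ≤ j) (hN : j ≤ N) :
    ∑ m ∈ range (j + 1), coeff m toddSeries * f (j + 1 - m) =
      ∑ n ∈ range N, coeff j (oneSubExpNeg ^ (n + 1)) / ((n : ℚ) + 1 + (i + 1 : ℕ)) := by
  calc
    _ = ∑ m ∈ range (j + 1), ∑ n ∈ range (N + 1), coeff m toddSeries *
          coeff (j + 1 - m) (oneSubExpNeg ^ (n + 1)) / ((n : ℚ) + 1 + i) := by
      refine Finset.sum_congr rfl fun m hm => ?_
      rw [Finset.mem_range] at hm
      rw [hf (j + 1 - m) (N + 1) (by omega) (by omega), Finset.mul_sum]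
      exact Finset.sum_congr rfl fun n _ => (mul_div_assoc _ _ _).symm
    _ = ∑ n ∈ range (N + 1), coeff j (oneSubExpNeg ^ n) / ((n : ℚ) + 1 + i) := by
      rw [Finset.sum_comm]
      refine Finset.sum_congr rfl fun n _ => ?_
      rw [← Finset.sum_div, sum_coeff_toddSeries_mul]
    _ = _ := by
      rw [Finset.sum_range_succ', pow_zero, coeff_one, if_neg (by omega), zero_div, add_zero]
      refine Finset.sum_congr rfl fun n _ => ?_
      push_cast
      ring

end oneSubExpNeg

open oneSubExpNeg in
/-- The generating function of `b i · 1` is `∑ uⁿ / (n + i)`, where `u = 1 - e^(-t)`. -/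
theorem b_one_eq_sum (i : ℕ) : ∀ j N, 1 ≤ j → j ≤ N → b (i + 1) j 1 =
    ∑ n ∈ range N, PowerSeries.coeff j (oneSubExpNeg ^ (n + 1)) / ((n : ℚ) + 1 + (i + 1 : ℕ)) := by
  induction i with
  | zero =>
    intro j N hj hN
    rw [← sum_toddSeries_step (f := fun j => if j = 1 then 1 else 0) (i := 0)
      (fun j N hj hN => by simpa using (sum_coeff_pow_div hj hN).symm) j N hj hN,
      Finset.sum_eq_single_of_mem j (by simp)]
    · simp [b, coeff_toddSeries]
    · intro m hm hmj
      rw [Finset.mem_range] at hm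
      rw [if_neg (by omega), mul_zero]
  | succ i ih =>
    intro j N hj hN
    rw [← sum_toddSeries_step ih j N hj hN, b, if_neg one_ne_zero, sub_zero,
      min_eq_left (by omega)]
    exact Finset.sum_congr rfl fun m _ => by rw [coeff_toddSeries]

/-- For every integer `i ≥ 1`, `b i 3 1 = (i² - i)/(6(i+1)(i+2)(i+3))`. -/
theorem b_three_one (i : ℕ) (hi : 1 ≤ i) :
    b i 3 1 = ((i : ℚ) ^ 2 - (i : ℚ)) / (6 * ((i : ℚ) + 1) * ((i : ℚ) + 2) * ((i : ℚ) + 3)) := by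
  obtain ⟨k, rfl⟩ : ∃ k, i = k + 1 := ⟨i - 1, by omega⟩
  have h1 : PowerSeries.coeff 3 oneSubExpNeg = 1 / 6 := by
    simp [oneSubExpNeg, PowerSeries.coeff_rescale, PowerSeries.coeff_exp, PowerSeries.coeff_one,
      Nat.factorial]
    norm_num
  have h2 : PowerSeries.coeff 3 (oneSubExpNeg ^ 2) = -1 := by
    rw [pow_two, PowerSeries.coeff_mul]
    simp [oneSubExpNeg, PowerSeries.coeff_rescale, PowerSeries.coeff_exp, PowerSeries.coeff_one,
      Nat.factorial, Finset.Nat.antidiagonal_succ]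
    norm_num
  have h3 : PowerSeries.coeff 3 (oneSubExpNeg ^ 3) = 1 := by
    rw [pow_succ, pow_two, PowerSeries.coeff_mul]
    simp [oneSubExpNeg, PowerSeries.coeff_rescale, PowerSeries.coeff_exp, PowerSeries.coeff_one,
      Nat.factorial, Finset.Nat.antidiagonal_succ, PowerSeries.coeff_mul]
  rw [b_one_eq_sum k 3 3 (by norm_num) le_rfl]
  simp only [Finset.sum_range_succ, Finset.sum_range_zero, Nat.reduceAdd, pow_one, h1, h2, h3]
  push_cast
  field_simp
  ring
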